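/- Let X and Y be two countable directed determined spaces and let X* = O(X) and Y* = O(Y) be their complete lattices of open sets ordered by inclusion. Then the product topology of the Scott spaces ΣX* and ΣY* coincides with the Scott topology of the product poset X* × Y*; that is, ΣX* × ΣY* = Σ(X* × Y*). -/

import Mathlib

open Topology TopologicalSpace

/-- A T₀ space is *directed determined* if an upper set `U` (in the specialization order
`x ≤ y ↔ x ∈ closure {y}`) is open iff for every directed subset `D` (directed in the
specialization order), `closure D ∩ U ≠ ∅` implies `D ∩ U ≠ ∅`. -/
def DirectedDetermined (X : Type) [TopologicalSpace X] : Prop :=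
  ∀ U : Set X, (∀ x y : X, x ∈ closure {y} → x ∈ U → y ∈ U) →
    (IsOpen U ↔ ∀ D : Set X, D.Nonempty → DirectedOn (fun a b => a ∈ closure {b}) D →
      (closure D ∩ U).Nonempty → (D ∩ U).Nonempty)

namespace DirectedDetermined

variable {X : Type} [TopologicalSpace X]

/-- If every point of the open set `U` lies in all but finitely many of the open sets `V m`, then
all sets `U ∩ ⋂ m ≥ n, V m` are open. -/
theorem isOpen_inter_iInter_ge (hX : DirectedDetermined X) (U : Opens X) (V : ℕ → Opens X)
    (hV : ∀ x ∈ U, ∃ N, ∀ m, N ≤ m → x ∈ V m) (n : ℕ) :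
    IsOpen {x | x ∈ U ∧ ∀ m, n ≤ m → x ∈ V m} := by
  have up : ∀ (O : Opens X) {x y : X}, x ∈ closure {y} → x ∈ O → y ∈ O := fun O x y hxy hx => by
    obtain ⟨z, hz, rfl⟩ := mem_closure_iff.1 hxy O O.isOpen hx
    exact hz
  refine (hX {x | x ∈ U ∧ ∀ m, n ≤ m → x ∈ V m} fun x y hxy hx =>
    ⟨up U hxy hx.1, fun m hm => up (V m) hxy (hx.2 m hm)⟩).2 ?_
  rintro D - hD ⟨y, hyD, hyU, hyV⟩
  obtain ⟨d, hdU, hdD⟩ := mem_closure_iff.1 hyD U U.isOpen hyU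
  obtain ⟨N, hN⟩ := hV d hdU
  have key : ∀ k, ∃ e ∈ D, d ∈ closure {e} ∧ ∀ m, n ≤ m → m < k → e ∈ V m := by
    intro k
    induction k with
    | zero => exact ⟨d, hdD, subset_closure rfl, fun m _ hm => absurd hm (Nat.not_lt_zero m)⟩
    | succ k ih =>
      obtain ⟨e, heD, hde, heV⟩ := ih
      by_cases hk : n ≤ k
      · obtain ⟨c, hcV, hcD⟩ := mem_closure_iff.1 hyD (V k) (V k).isOpen (hyV k hk)
        obtain ⟨f, hfD, hef, hcf⟩ := hD e heD c hcD
        refine ⟨f, hfD, closure_minimal (Set.singleton_subset_iff.2 hef) isClosed_closure hde,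
          fun m hm hmk => ?_⟩
        rcases Nat.lt_succ_iff_lt_or_eq.1 hmk with h | rfl
        · exact up _ hef (heV m hm h)
        · exact up _ hcf hcV
      · exact ⟨e, heD, hde, fun m hm hmk => by omega⟩
  obtain ⟨e, heD, hde, heV⟩ := key N
  refine ⟨e, heD, up U hde hdU, fun m hm => ?_⟩
  rcases lt_or_ge m N with h | h
  · exact heV m hm h
  · exact up _ hde (hN m h)

/-- A sequence of open sets which eventually contains each point of `U` dominates an increasing
sequence of open sets covering `U`. -/
theorem exists_monotone_le (hX : DirectedDetermined X) (U : Opens X) (V : ℕ → Opens X)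
    (hV : ∀ x ∈ U, ∃ N, ∀ m, N ≤ m → x ∈ V m) :
    ∃ A : ℕ → Opens X, Monotone A ∧ (∀ n, A n ≤ V n) ∧ U ≤ ⨆ n, A n := by
  refine ⟨fun n => ⟨_, hX.isOpen_inter_iInter_ge U V hV n⟩, ?_, ?_, ?_⟩
  · exact fun i j hij x hx => ⟨hx.1, fun m hm => hx.2 m (hij.trans hm)⟩
  · exact fun n x hx => hx.2 n le_rfl
  · intro x hx
    obtain ⟨N, hN⟩ := hV x hx
    exact Opens.mem_iSup.2 ⟨N, hx, hN⟩

end DirectedDetermined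

/-- A countable set is the pointwise limit of a sequence of finite subsets. -/
theorem exists_seq_finite_subset_eventually_mem {X : Type*} [Countable X] (s : Set X) :
    ∃ F : ℕ → Set X, (∀ n, (F n).Finite) ∧ (∀ n, F n ⊆ s) ∧
      ∀ x ∈ s, ∃ N, ∀ m, N ≤ m → x ∈ F m := by
  obtain ⟨f, hf⟩ := exists_injective_nat X
  refine ⟨fun n => {x | x ∈ s ∧ f x < n}, fun n => ?_, fun n x hx => hx.1, fun x hx =>
    ⟨f x + 1, fun m hm => ⟨hx, hm⟩⟩⟩
  exact ((Set.finite_lt_nat n).preimage hf.injOn).subset fun x hx => hx.2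

/-- A Scott open family of pairs of open sets contains, around each of its members, a basic open
set of the topology of pointwise convergence. -/
theorem exists_finite_subset_of_dirSupInacc {X Y : Type} [TopologicalSpace X]
    [TopologicalSpace Y] [Countable X] [Countable Y] (hX : DirectedDetermined X)
    (hY : DirectedDetermined Y) {W : Set (Opens X × Opens Y)} (hWu : IsUpperSet W)
    (hWd : DirSupInacc W) {U : Opens X} {V : Opens Y} (hUV : (U, V) ∈ W) :
    ∃ (F : Set X) (G : Set Y), F.Finite ∧ G.Finite ∧ F ⊆ U ∧ G ⊆ V ∧
      ∀ (U' : Opens X) (V' : Opens Y), F ⊆ U' → G ⊆ V' → (U', V') ∈ W := by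
  by_contra! h
  obtain ⟨F, hFf, hFU, hF⟩ := exists_seq_finite_subset_eventually_mem (U : Set X)
  obtain ⟨G, hGf, hGV, hG⟩ := exists_seq_finite_subset_eventually_mem (V : Set Y)
  choose P Q hP hQ hPQ using fun n => h (F n) (G n) (hFf n) (hGf n) (hFU n) (hGV n)
  obtain ⟨A, hAm, hAP, hA⟩ := hX.exists_monotone_le U P fun x hx =>
    (hF x hx).imp fun N hN m hm => hP m (hN m hm)
  obtain ⟨B, hBm, hBQ, hB⟩ := hY.exists_monotone_le V Q fun y hy =>
    (hG y hy).imp fun N hN m hm => hQ m (hN m hm)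
  have hdir : Directed (· ≤ ·) fun n => (A n, B n) :=
    Monotone.directed_le fun i j hij => ⟨hAm hij, hBm hij⟩
  have hmem : (⨆ n, (A n, B n)) ∈ W := by
    refine hWu ?_ hUV
    exact ⟨by simpa [Prod.fst_iSup] using hA, by simpa [Prod.snd_iSup] using hB⟩
  obtain ⟨_, ⟨n, rfl⟩, hn⟩ :=
    hWd (Set.range_nonempty _) hdir.directedOn_range isLUB_iSup hmem
  exact hPQ n (hWu ⟨hAP n, hBQ n⟩ hn)

theorem isOpen_scott_iff {α : Type*} [Preorder α] {s : Set α} :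
    IsOpen[Topology.scott α Set.univ] s ↔ IsUpperSet s ∧ DirSupInacc s := by
  let := Topology.scott α Set.univ
  have : IsScott α Set.univ := ⟨rfl⟩
  rw [IsScott.isOpen_iff_isUpperSet_and_dirSupInaccOn (D := Set.univ), dirSupInaccOn_univ]

theorem isOpen_scott_setOf_subset {X : Type*} [TopologicalSpace X] {F : Set X} (hF : F.Finite) :
    IsOpen[Topology.scott (Opens X) Set.univ] {U : Opens X | F ⊆ U} := by
  let := Topology.scott (Opens X) Set.univ
  have : {U : Opens X | F ⊆ U} = ⋂ x ∈ F, {U : Opens X | x ∈ U} := by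
    ext U
    simp [Set.subset_def]
  rw [this]
  refine hF.isOpen_biInter fun x _ => isOpen_scott_iff.2 ⟨fun U V hUV hx => hUV hx, ?_⟩
  intro d _ _ U hU hx
  rw [← hU.sSup_eq] at hx
  exact Opens.mem_sSup.1 hx

/-- For countable directed determined spaces `X` and `Y`, with `X* = O(X)` and
`Y* = O(Y)` the complete lattices of open sets ordered by inclusion, the product topology of
the Scott spaces `ΣX*` and `ΣY*` coincides with the Scott topology of the product poset
`X* × Y*`. -/
theorem prod_topology_eq_scott_topology_of_directedDetermined
    (X Y : Type) [TopologicalSpace X] [TopologicalSpace Y] [T0Space X] [T0Space Y]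
    [Countable X] [Countable Y] (hX : DirectedDetermined X) (hY : DirectedDetermined Y) :
    @instTopologicalSpaceProd (Opens X) (Opens Y)
        (Topology.scott (Opens X) Set.univ) (Topology.scott (Opens Y) Set.univ)
      = Topology.scott (Opens X × Opens Y) Set.univ := by
  let := Topology.scott (Opens X) Set.univ
  let := Topology.scott (Opens Y) Set.univ
  apply le_antisymm
  · intro W hW
    obtain ⟨hWu, hWd⟩ := isOpen_scott_iff.1 hW
    refine isOpen_prod_iff.2 fun U V hUV => ?_
    obtain ⟨F, G, hF, hG, hFU, hGV, hFG⟩ :=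
      exists_finite_subset_of_dirSupInacc hX hY hWu hWd hUV
    exact ⟨_, _, isOpen_scott_setOf_subset hF, isOpen_scott_setOf_subset hG, hFU, hGV,
      fun p hp => hFG p.1 p.2 hp.1 hp.2⟩
  · refine le_inf ?_ ?_
    · rintro _ ⟨S, hS, rfl⟩
      obtain ⟨hSu, hSd⟩ := isOpen_scott_iff.1 hS
      refine isOpen_scott_iff.2 ⟨hSu.preimage monotone_fst, fun d hne hd p hp hpS => ?_⟩
      exact Set.image_inter_nonempty_iff.1 <|
        hSd (hne.image Prod.fst) hd.fst (isLUB_prod.1 hp).1 hpS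
    · rintro _ ⟨S, hS, rfl⟩
      obtain ⟨hSu, hSd⟩ := isOpen_scott_iff.1 hS
      refine isOpen_scott_iff.2 ⟨hSu.preimage monotone_snd, fun d hne hd p hp hpS => ?_⟩
      exact Set.image_inter_nonempty_iff.1 <|
        hSd (hne.image Prod.snd) hd.snd (isLUB_prod.1 hp).2 hpS
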